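/- Let Φ be a real M×N matrix (M ≤ N) with Φ Φᵀ invertible and satisfying the restricted isometry property of order K with constant δ ∈ (0,1), let Q = Φᵀ (Φ Φᵀ)⁻¹ Φ, and let s ∈ ℝ^N have at most K nonzero entries. Then (1−δ) ‖s‖₂² / λ_max(Φ Φᵀ) ≤ ‖Q s‖₂² ≤ (1+δ) ‖s‖₂² / λ_min(Φ Φᵀ). (This is the deterministic core of the bound on the Shiryaev delay for RIP sensing matrices: the Kullback–Leibler number ‖Qs‖₂²/(2σ²) is sandwiched between (1−δ)SNR/(2λ_max) and (1+δ)SNR/(2λ_min) with SNR = ‖s‖₂²/σ².) -/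

import Mathlib

open Matrix

/-- The Euclidean (`ℓ₂`) norm of a vector in `ℝ^n`. -/
noncomputable def euclNorm {n : ℕ} (v : Fin n → ℝ) : ℝ :=
  Real.sqrt (∑ i, (v i) ^ 2)

/-- The smallest eigenvalue of a real square matrix, as the infimum of its spectrum. -/
noncomputable def lamMin {n : Type*} [Fintype n] [DecidableEq n]
    (A : Matrix n n ℝ) : ℝ :=
  sInf (spectrum ℝ A)

/-- The largest eigenvalue of a real square matrix, as the supremum of its spectrum. -/
noncomputable def lamMax {n : Type*} [Fintype n] [DecidableEq n]
    (A : Matrix n n ℝ) : ℝ :=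
  sSup (spectrum ℝ A)

theorem euclNorm_sq {n : ℕ} (v : Fin n → ℝ) : euclNorm v ^ 2 = v ⬝ᵥ v := by
  rw [euclNorm, Real.sq_sqrt (Finset.sum_nonneg fun i _ => sq_nonneg (v i))]
  simp [dotProduct, sq]

section Spectral

variable {n : Type*} [Fintype n] [DecidableEq n] {A : Matrix n n ℝ}

theorem Matrix.IsHermitian.sum_dotProduct_eigenvectorBasis (hA : A.IsHermitian) (u v : n → ℝ) :
    ∑ i, (hA.eigenvectorBasis i ⬝ᵥ u) * (hA.eigenvectorBasis i ⬝ᵥ v) = u ⬝ᵥ v := by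
  have h := hA.eigenvectorBasis.sum_inner_mul_inner (WithLp.toLp 2 u) (WithLp.toLp 2 v)
  simpa [EuclideanSpace.inner_eq_star_dotProduct, dotProduct_comm] using h

theorem Matrix.IsHermitian.eigenvectorBasis_dotProduct_mulVec (hA : A.IsHermitian) (z : n → ℝ)
    (i : n) :
    hA.eigenvectorBasis i ⬝ᵥ A *ᵥ z = hA.eigenvalues i * (hA.eigenvectorBasis i ⬝ᵥ z) := by
  have hT : Aᵀ = A := by simpa using hA.eq
  rw [dotProduct_mulVec, ← mulVec_transpose, hT, hA.mulVec_eigenvectorBasis, smul_dotProduct,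
    smul_eq_mul]

theorem Matrix.IsHermitian.dotProduct_mulVec_eq_sum (hA : A.IsHermitian) (z : n → ℝ) :
    z ⬝ᵥ A *ᵥ z = ∑ i, hA.eigenvalues i * (hA.eigenvectorBasis i ⬝ᵥ z) ^ 2 := by
  rw [← hA.sum_dotProduct_eigenvectorBasis]
  exact Finset.sum_congr rfl fun i _ => by rw [hA.eigenvectorBasis_dotProduct_mulVec]; ring

theorem Matrix.IsHermitian.mulVec_dotProduct_mulVec_eq_sum (hA : A.IsHermitian) (z : n → ℝ) :
    A *ᵥ z ⬝ᵥ A *ᵥ z =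
      ∑ i, hA.eigenvalues i * (hA.eigenvalues i * (hA.eigenvectorBasis i ⬝ᵥ z) ^ 2) := by
  rw [← hA.sum_dotProduct_eigenvectorBasis]
  exact Finset.sum_congr rfl fun i _ => by rw [hA.eigenvectorBasis_dotProduct_mulVec]; ring

theorem Matrix.IsHermitian.eigenvalues_le_lamMax (hA : A.IsHermitian) (i : n) :
    hA.eigenvalues i ≤ lamMax A := by
  rw [lamMax, hA.spectrum_real_eq_range_eigenvalues]
  exact le_csSup (Set.finite_range _).bddAbove ⟨i, rfl⟩

theorem Matrix.IsHermitian.lamMin_le_eigenvalues (hA : A.IsHermitian) (i : n) :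
    lamMin A ≤ hA.eigenvalues i := by
  rw [lamMin, hA.spectrum_real_eq_range_eigenvalues]
  exact csInf_le (Set.finite_range _).bddBelow ⟨i, rfl⟩

theorem Matrix.PosDef.lamMin_pos [Nonempty n] (hA : A.PosDef) : 0 < lamMin A := by
  rw [lamMin, hA.1.spectrum_real_eq_range_eigenvalues]
  obtain ⟨i, hi⟩ := (Set.range_nonempty hA.1.eigenvalues).csInf_mem (Set.finite_range _)
  rw [← hi]
  exact hA.eigenvalues_pos i

theorem Matrix.PosSemidef.mulVec_dotProduct_mulVec_le (hA : A.PosSemidef) (z : n → ℝ) :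
    A *ᵥ z ⬝ᵥ A *ᵥ z ≤ lamMax A * (z ⬝ᵥ A *ᵥ z) := by
  rw [hA.1.mulVec_dotProduct_mulVec_eq_sum, hA.1.dotProduct_mulVec_eq_sum, Finset.mul_sum]
  gcongr with i
  · exact mul_nonneg (hA.eigenvalues_nonneg i) (sq_nonneg _)
  · exact hA.1.eigenvalues_le_lamMax i

theorem Matrix.PosSemidef.le_mulVec_dotProduct_mulVec (hA : A.PosSemidef) (z : n → ℝ) :
    lamMin A * (z ⬝ᵥ A *ᵥ z) ≤ A *ᵥ z ⬝ᵥ A *ᵥ z := by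
  rw [hA.1.mulVec_dotProduct_mulVec_eq_sum, hA.1.dotProduct_mulVec_eq_sum, Finset.mul_sum]
  gcongr with i
  · exact mul_nonneg (hA.eigenvalues_nonneg i) (sq_nonneg _)
  · exact hA.1.lamMin_le_eigenvalues i

end Spectral

/-- if `Φ` has invertible `Φ Φᵀ` and satisfies the RIP of order `K` with
constant `δ ∈ (0,1)`, and `s` has at most `K` nonzero entries, then
`(1−δ)‖s‖₂²/λ_max(ΦΦᵀ) ≤ ‖Qs‖₂² ≤ (1+δ)‖s‖₂²/λ_min(ΦΦᵀ)` for `Q = Φᵀ (ΦΦᵀ)⁻¹ Φ`. -/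
theorem RIP_projected_energy_bounds {M N K : ℕ} (hMN : M ≤ N)
    (Φ : Matrix (Fin M) (Fin N) ℝ) (hinv : IsUnit (Φ * Φᵀ))
    (δ : ℝ) (hδ : δ ∈ Set.Ioo (0 : ℝ) 1)
    (hRIP : ∀ x : Fin N → ℝ, ({i | x i ≠ 0} : Set (Fin N)).toFinset.card ≤ K →
      (1 - δ) * (euclNorm x) ^ 2 ≤ (euclNorm (Φ.mulVec x)) ^ 2 ∧
      (euclNorm (Φ.mulVec x)) ^ 2 ≤ (1 + δ) * (euclNorm x) ^ 2)
    (s : Fin N → ℝ) (hs : ({i | s i ≠ 0} : Set (Fin N)).toFinset.card ≤ K) :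
    (1 - δ) * (euclNorm s) ^ 2 / lamMax (Φ * Φᵀ) ≤
      (euclNorm ((Φᵀ * (Φ * Φᵀ)⁻¹ * Φ).mulVec s)) ^ 2 ∧
    (euclNorm ((Φᵀ * (Φ * Φᵀ)⁻¹ * Φ).mulVec s)) ^ 2 ≤
      (1 + δ) * (euclNorm s) ^ 2 / lamMin (Φ * Φᵀ) := by
  have hpsd : (Φ * Φᵀ).PosSemidef := by
    simpa using posSemidef_self_mul_conjTranspose Φ
  have hpd : (Φ * Φᵀ).PosDef := hpsd.posDef_iff_isUnit.mpr hinv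
  obtain ⟨hlow, hupp⟩ := hRIP s hs
  set z := (Φ * Φᵀ)⁻¹ *ᵥ Φ *ᵥ s with hz
  have hGz : (Φ * Φᵀ) *ᵥ z = Φ *ᵥ s := by
    rw [hz, mulVec_mulVec, mul_nonsing_inv _ ((isUnit_iff_isUnit_det _).mp hinv), one_mulVec]
  have hQ : euclNorm ((Φᵀ * (Φ * Φᵀ)⁻¹ * Φ) *ᵥ s) ^ 2 = z ⬝ᵥ (Φ * Φᵀ) *ᵥ z := by
    rw [euclNorm_sq, ← mulVec_mulVec, ← mulVec_mulVec, ← hz, ← mulVec_mulVec,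
      dotProduct_mulVec z, ← mulVec_transpose]
  rw [hQ]
  rw [euclNorm_sq (Φ *ᵥ s), ← hGz] at hlow hupp
  have hmax := hpsd.mulVec_dotProduct_mulVec_le z
  have hmin := hpsd.le_mulVec_dotProduct_mulVec z
  cases isEmpty_or_nonempty (Fin M) with
  | inl _ => simp [lamMax, lamMin, spectrum.of_subsingleton]
  | inr hne =>
    have hpos := hpd.lamMin_pos
    have hpos' : 0 < lamMax (Φ * Φᵀ) :=
      hpos.trans_le ((hpd.1.lamMin_le_eigenvalues hne.some).trans
        (hpd.1.eigenvalues_le_lamMax hne.some))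
    rw [div_le_iff₀ hpos', le_div_iff₀ hpos]
    constructor <;> linarith
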